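/- Let p ≥ 5 be a prime and let M be the Lie ring ⟨a, b | [b,a,b] − [b,a,a,a] − [b,a,a,a,a,a], [b,a,a,a,b] − [b,a,a,a,a,a], p•a, p•b, class 6⟩, i.e., the quotient of the free Lie ring on generators a, b by the Lie ideal generated by the listed elements together with the 7th term of the lower central series. Then the number of isomorphism classes of Lie rings L of cardinality p^8, nilpotent of class exactly 7, with L/L⁷ ≅ M equals p³ − (p² − p)/2. -/

import Mathlib

/-- An isomorphism between two Lie rings (Lie algebras over `ℤ`) exists. -/
def IsLieIso (α β : Type*) [LieRing α] [LieRing β] : Prop :=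
  ∃ e : α ≃ β, (∀ x y, e (x + y) = e x + e y) ∧ (∀ x y, e ⁅x, y⁆ = ⁅e x, e y⁆)

/-- A Lie ring is nilpotent of class exactly `c`: `L^{c+1} = 0` and `L^c ≠ 0`. -/
def LieClassEq (α : Type*) [LieRing α] (c : ℕ) : Prop :=
  LieModule.lowerCentralSeries ℤ α α c = ⊥ ∧ LieModule.lowerCentralSeries ℤ α α (c - 1) ≠ ⊥

/-- The free Lie ring on two generators. -/
abbrev FL : Type := FreeLieAlgebra ℤ (Fin 2)

/-- The generator `a`. -/
noncomputable def ga : FL := FreeLieAlgebra.of ℤ 0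
/-- The generator `b`. -/
noncomputable def gb : FL := FreeLieAlgebra.of ℤ 1
/-- The left-normed bracket `[b,a,b]`. -/
noncomputable def bab : FL := ⁅⁅gb, ga⁆, gb⁆
/-- The left-normed bracket `[b,a,a,a]`. -/
noncomputable def ba3 : FL := ⁅⁅⁅gb, ga⁆, ga⁆, ga⁆
/-- The left-normed bracket `[b,a,a,a,b]`. -/
noncomputable def ba3b : FL := ⁅ba3, gb⁆
/-- The left-normed bracket `[b,a,a,a,a]`. -/
noncomputable def ba4 : FL := ⁅ba3, ga⁆
/-- The left-normed bracket `[b,a,a,a,a,a]`. -/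
noncomputable def ba5 : FL := ⁅ba4, ga⁆

/-- The quotient of the free Lie ring on `a, b` by the Lie ideal generated by the
given relator set together with `p•a`, `p•b` and the 7th term of the lower central
series (i.e. the presentation is of class at most 6). -/
abbrev presLie (p : ℕ) (rels : Set FL) : Type :=
  FL ⧸ (LieSubmodule.lieSpan ℤ FL (rels ∪ {p • ga, p • gb}) ⊔
    LieModule.lowerCentralSeries ℤ FL FL 6)

/-- `s` is a Lie ring structure of maximal class 7 on a set of size `p^8` whose
quotient by the 7th term of the lower central series is isomorphic to `β`. -/
def IsMaxClassDescendantOf (p : ℕ) (β : Type*) [LieRing β]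
    (s : LieRing (Fin (p ^ 8))) : Prop := by
  letI := s
  exact LieClassEq (Fin (p ^ 8)) 7 ∧
    IsLieIso (Fin (p ^ 8) ⧸ LieModule.lowerCentralSeries ℤ (Fin (p ^ 8)) (Fin (p ^ 8)) 6) β


/-- The carry, modulo `p`, of the addition of two residues. -/
def carry {p : ℕ} (s t : ZMod p) : ZMod p := (((s.val + t.val) / p : ℕ) : ZMod p)

theorem carry_comm {p : ℕ} (s t : ZMod p) : carry s t = carry t s := by
  simp [carry, add_comm]

theorem Nat.mod_add_div_add_div (p m n : ℕ) (hp : 0 < p) :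
    (m % p + n) / p + m / p = (m + n) / p := by
  conv_rhs => rw [← Nat.mod_add_div m p]
  rw [show m % p + p * (m / p) + n = m % p + n + p * (m / p) by ring,
    Nat.add_mul_div_left _ _ hp]

section Carry

variable {p : ℕ} [NeZero p]

@[simp] theorem carry_zero_right (s : ZMod p) : carry s 0 = 0 := by
  simp [carry, Nat.div_eq_of_lt (ZMod.val_lt s)]

@[simp] theorem carry_zero_left (s : ZMod p) : carry 0 s = 0 := by
  rw [carry_comm, carry_zero_right]

theorem carry_assoc (r s t : ZMod p) :
    carry r s + carry (r + s) t = carry s t + carry r (s + t) := by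
  have key : ∀ r s t : ZMod p,
      carry r s + carry (r + s) t = (((r.val + s.val + t.val) / p : ℕ) : ZMod p) := by
    intro r s t
    rw [carry, carry, ZMod.val_add, ← Nat.mod_add_div_add_div p (r.val + s.val) _ (NeZero.pos p),
      Nat.cast_add, add_comm]
  rw [key, carry_comm r, key]
  congr 2
  ring

theorem natCast_mul_div_add_carry (n : ℕ) (s : ZMod p) :
    ((n * s.val / p : ℕ) : ZMod p) + carry ((n : ZMod p) * s) s =
      (((n + 1) * s.val / p : ℕ) : ZMod p) := by
  have h : ((n : ZMod p) * s).val = n * s.val % p := by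
    conv_lhs => rw [← ZMod.natCast_zmod_val s, ← Nat.cast_mul, ZMod.val_natCast]
  rw [carry, h, add_mul, one_mul, ← Nat.mod_add_div_add_div p (n * s.val) _ (NeZero.pos p),
    Nat.cast_add, add_comm]

end Carry

/-- The underlying set of the Lie ring of maximal class on `a, b` with
`[b,a,b] = c₃ + c₅ + u c₆`, `[c₃,b] = c₅ + v c₆`, `p a = x c₆`, `p b = y c₆`,
where `cᵢ = [b,a,…,a]` with `i` entries `a`. -/
@[ext]
structure Model (p : ℕ) (u v x y : ZMod p) where
  /-- The coordinate at `a`. -/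
  a : ZMod p
  /-- The coordinate at `b`. -/
  b : ZMod p
  /-- The coordinate at `c₁`. -/
  c1 : ZMod p
  /-- The coordinate at `c₂`. -/
  c2 : ZMod p
  /-- The coordinate at `c₃`. -/
  c3 : ZMod p
  /-- The coordinate at `c₄`. -/
  c4 : ZMod p
  /-- The coordinate at `c₅`. -/
  c5 : ZMod p
  /-- The coordinate at `c₆`. -/
  c6 : ZMod p

namespace Model

variable {p : ℕ} {u v x y : ZMod p}

instance : Zero (Model p u v x y) := ⟨⟨0, 0, 0, 0, 0, 0, 0, 0⟩⟩

instance : Add (Model p u v x y) :=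
  ⟨fun X Y => ⟨X.a + Y.a, X.b + Y.b, X.c1 + Y.c1, X.c2 + Y.c2, X.c3 + Y.c3, X.c4 + Y.c4,
    X.c5 + Y.c5, X.c6 + Y.c6 + x * carry X.a Y.a + y * carry X.b Y.b⟩⟩

instance : Neg (Model p u v x y) :=
  ⟨fun X => ⟨-X.a, -X.b, -X.c1, -X.c2, -X.c3, -X.c4,
    -X.c5, -X.c6 - x * carry X.a (-X.a) - y * carry X.b (-X.b)⟩⟩

instance : Bracket (Model p u v x y) (Model p u v x y) :=
  ⟨fun X Y => ⟨0, 0, X.b * Y.a - X.a * Y.b, X.c1 * Y.a - X.a * Y.c1,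
    (X.c2 * Y.a - X.a * Y.c2) + (X.c1 * Y.b - X.b * Y.c1),
    (X.c3 * Y.a - X.a * Y.c3) + (X.c2 * Y.b - X.b * Y.c2),
    (X.c4 * Y.a - X.a * Y.c4) + (X.c1 * Y.b - X.b * Y.c1) + (X.c3 * Y.b - X.b * Y.c3),
    (X.c5 * Y.a - X.a * Y.c5) + u * (X.c1 * Y.b - X.b * Y.c1) + (X.c2 * Y.b - X.b * Y.c2)
      + v * (X.c3 * Y.b - X.b * Y.c3) + (X.c4 * Y.b - X.b * Y.c4)
      - v * (X.c2 * Y.c1 - X.c1 * Y.c2)⟩⟩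

@[simp] theorem zero_a : (0 : Model p u v x y).a = 0 := rfl
@[simp] theorem zero_b : (0 : Model p u v x y).b = 0 := rfl
@[simp] theorem zero_c1 : (0 : Model p u v x y).c1 = 0 := rfl
@[simp] theorem zero_c2 : (0 : Model p u v x y).c2 = 0 := rfl
@[simp] theorem zero_c3 : (0 : Model p u v x y).c3 = 0 := rfl
@[simp] theorem zero_c4 : (0 : Model p u v x y).c4 = 0 := rfl
@[simp] theorem zero_c5 : (0 : Model p u v x y).c5 = 0 := rfl
@[simp] theorem zero_c6 : (0 : Model p u v x y).c6 = 0 := rfl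

/-- The multiple `t c₆` of the basis element `c₆`. -/
def top (t : ZMod p) : Model p u v x y := ⟨0, 0, 0, 0, 0, 0, 0, t⟩

@[simp] theorem top_a (t : ZMod p) : (top t : Model p u v x y).a = 0 := rfl
@[simp] theorem top_b (t : ZMod p) : (top t : Model p u v x y).b = 0 := rfl
@[simp] theorem top_c1 (t : ZMod p) : (top t : Model p u v x y).c1 = 0 := rfl
@[simp] theorem top_c2 (t : ZMod p) : (top t : Model p u v x y).c2 = 0 := rfl
@[simp] theorem top_c3 (t : ZMod p) : (top t : Model p u v x y).c3 = 0 := rfl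
@[simp] theorem top_c4 (t : ZMod p) : (top t : Model p u v x y).c4 = 0 := rfl
@[simp] theorem top_c5 (t : ZMod p) : (top t : Model p u v x y).c5 = 0 := rfl
@[simp] theorem top_c6 (t : ZMod p) : (top t : Model p u v x y).c6 = t := rfl

/-- The generator `a`. -/
def genA : Model p u v x y := ⟨1, 0, 0, 0, 0, 0, 0, 0⟩

/-- The generator `b`. -/
def genB : Model p u v x y := ⟨0, 1, 0, 0, 0, 0, 0, 0⟩

@[simp] theorem genA_a : (genA : Model p u v x y).a = 1 := rfl
@[simp] theorem genA_b : (genA : Model p u v x y).b = 0 := rfl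
@[simp] theorem genA_c1 : (genA : Model p u v x y).c1 = 0 := rfl
@[simp] theorem genA_c2 : (genA : Model p u v x y).c2 = 0 := rfl
@[simp] theorem genA_c3 : (genA : Model p u v x y).c3 = 0 := rfl
@[simp] theorem genA_c4 : (genA : Model p u v x y).c4 = 0 := rfl
@[simp] theorem genA_c5 : (genA : Model p u v x y).c5 = 0 := rfl
@[simp] theorem genA_c6 : (genA : Model p u v x y).c6 = 0 := rfl

@[simp] theorem genB_a : (genB : Model p u v x y).a = 0 := rfl
@[simp] theorem genB_b : (genB : Model p u v x y).b = 1 := rfl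
@[simp] theorem genB_c1 : (genB : Model p u v x y).c1 = 0 := rfl
@[simp] theorem genB_c2 : (genB : Model p u v x y).c2 = 0 := rfl
@[simp] theorem genB_c3 : (genB : Model p u v x y).c3 = 0 := rfl
@[simp] theorem genB_c4 : (genB : Model p u v x y).c4 = 0 := rfl
@[simp] theorem genB_c5 : (genB : Model p u v x y).c5 = 0 := rfl
@[simp] theorem genB_c6 : (genB : Model p u v x y).c6 = 0 := rfl

variable (X Y : Model p u v x y)

@[simp] theorem add_a : (X + Y).a = X.a + Y.a := rfl
@[simp] theorem add_b : (X + Y).b = X.b + Y.b := rfl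
@[simp] theorem add_c1 : (X + Y).c1 = X.c1 + Y.c1 := rfl
@[simp] theorem add_c2 : (X + Y).c2 = X.c2 + Y.c2 := rfl
@[simp] theorem add_c3 : (X + Y).c3 = X.c3 + Y.c3 := rfl
@[simp] theorem add_c4 : (X + Y).c4 = X.c4 + Y.c4 := rfl
@[simp] theorem add_c5 : (X + Y).c5 = X.c5 + Y.c5 := rfl
@[simp] theorem add_c6 :
    (X + Y).c6 = X.c6 + Y.c6 + x * carry X.a Y.a + y * carry X.b Y.b := rfl

@[simp] theorem neg_a : (-X).a = -X.a := rfl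
@[simp] theorem neg_b : (-X).b = -X.b := rfl
@[simp] theorem neg_c1 : (-X).c1 = -X.c1 := rfl
@[simp] theorem neg_c2 : (-X).c2 = -X.c2 := rfl
@[simp] theorem neg_c3 : (-X).c3 = -X.c3 := rfl
@[simp] theorem neg_c4 : (-X).c4 = -X.c4 := rfl
@[simp] theorem neg_c5 : (-X).c5 = -X.c5 := rfl
@[simp] theorem neg_c6 :
    (-X).c6 = -X.c6 - x * carry X.a (-X.a) - y * carry X.b (-X.b) := rfl

@[simp] theorem lie_a : ⁅X, Y⁆.a = 0 := rfl
@[simp] theorem lie_b : ⁅X, Y⁆.b = 0 := rfl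
@[simp] theorem lie_c1 : ⁅X, Y⁆.c1 = X.b * Y.a - X.a * Y.b := rfl
@[simp] theorem lie_c2 : ⁅X, Y⁆.c2 = X.c1 * Y.a - X.a * Y.c1 := rfl
@[simp] theorem lie_c3 :
    ⁅X, Y⁆.c3 = (X.c2 * Y.a - X.a * Y.c2) + (X.c1 * Y.b - X.b * Y.c1) := rfl
@[simp] theorem lie_c4 :
    ⁅X, Y⁆.c4 = (X.c3 * Y.a - X.a * Y.c3) + (X.c2 * Y.b - X.b * Y.c2) := rfl
@[simp] theorem lie_c5 :
    ⁅X, Y⁆.c5 = (X.c4 * Y.a - X.a * Y.c4) + (X.c1 * Y.b - X.b * Y.c1)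
      + (X.c3 * Y.b - X.b * Y.c3) := rfl
@[simp] theorem lie_c6 :
    ⁅X, Y⁆.c6 = (X.c5 * Y.a - X.a * Y.c5) + u * (X.c1 * Y.b - X.b * Y.c1)
      + (X.c2 * Y.b - X.b * Y.c2) + v * (X.c3 * Y.b - X.b * Y.c3) + (X.c4 * Y.b - X.b * Y.c4)
      - v * (X.c2 * Y.c1 - X.c1 * Y.c2) := rfl

variable [NeZero p]

instance : AddCommGroup (Model p u v x y) where
  add_assoc X Y Z := by
    ext
    case c6 =>
      simp only [add_a, add_b, add_c6]
      linear_combination x * carry_assoc X.a Y.a Z.a + y * carry_assoc X.b Y.b Z.b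
    all_goals
      simp only [add_a, add_b, add_c1, add_c2, add_c3, add_c4, add_c5]
      ring
  zero_add X := by ext <;> simp
  add_zero X := by ext <;> simp
  nsmul := nsmulRec
  zsmul := zsmulRec
  neg_add_cancel X := by
    ext <;> simp [carry_comm]
    ring
  add_comm X Y := by
    ext <;> simp [add_comm, carry_comm]

instance : LieRing (Model p u v x y) where
  add_lie X Y Z := by
    ext <;> simp <;> ring
  lie_add X Y Z := by
    ext <;> simp <;> ring
  lie_self X := by
    ext <;> simp <;> ring
  leibniz_lie X Y Z := by
    ext <;> simp <;> ring

theorem nsmul_eq (n : ℕ) (X : Model p u v x y) :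
    n • X = ⟨n * X.a, n * X.b, n * X.c1, n * X.c2, n * X.c3, n * X.c4, n * X.c5,
      n * X.c6 + x * ((n * X.a.val / p : ℕ) : ZMod p)
        + y * ((n * X.b.val / p : ℕ) : ZMod p)⟩ := by
  induction n with
  | zero => ext <;> simp
  | succ n ih =>
    rw [succ_nsmul, ih]
    ext
    case c6 =>
      simp only [add_c6]
      rw [← natCast_mul_div_add_carry, ← natCast_mul_div_add_carry]
      push_cast
      ring
    all_goals
      simp only [add_a, add_b, add_c1, add_c2, add_c3, add_c4, add_c5]
      push_cast
      ring

theorem p_nsmul (X : Model p u v x y) : p • X = top (x * X.a + y * X.b) := by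
  rw [nsmul_eq]
  ext <;> simp [Nat.mul_div_cancel_left _ (NeZero.pos p)]

theorem val_nsmul_top (s t : ZMod p) :
    s.val • (top t : Model p u v x y) = top (s * t) := by
  rw [nsmul_eq]
  ext <;> simp

end Model

/-- The left-normed bracket `[b,a,…,a]` with `n` entries `a`. -/
def adPow {L : Type*} [LieRing L] (a b : L) : ℕ → L
  | 0 => b
  | n + 1 => ⁅adPow a b n, a⁆

section Table

variable {L : Type*} [LieRing L]

theorem lie_lie_right (x y z : L) : ⁅x, ⁅y, z⁆⁆ = ⁅⁅x, y⁆, z⁆ - ⁅⁅x, z⁆, y⁆ := by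
  rw [leibniz_lie, ← lie_skew y ⁅x, z⁆]
  abel

@[simp] theorem adPow_zero (a b : L) : adPow a b 0 = b := rfl

theorem adPow_succ (a b : L) (n : ℕ) : adPow a b (n + 1) = ⁅adPow a b n, a⁆ := rfl

theorem adPow_one (a b : L) : adPow a b 1 = ⁅adPow a b 0, a⁆ := rfl

theorem adPow_two (a b : L) : adPow a b 2 = ⁅adPow a b 1, a⁆ := rfl

theorem adPow_three (a b : L) : adPow a b 3 = ⁅adPow a b 2, a⁆ := rfl

theorem adPow_four (a b : L) : adPow a b 4 = ⁅adPow a b 3, a⁆ := rfl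

theorem adPow_five (a b : L) : adPow a b 5 = ⁅adPow a b 4, a⁆ := rfl

theorem adPow_six (a b : L) : adPow a b 6 = ⁅adPow a b 5, a⁆ := rfl

theorem lie_adPow_succ (a b x : L) (n : ℕ) :
    ⁅x, adPow a b (n + 1)⁆ = ⁅⁅x, adPow a b n⁆, a⁆ - ⁅⁅x, a⁆, adPow a b n⁆ :=
  lie_lie_right _ _ _

/-- All left-normed brackets of weight eight vanish. -/
def NilEight (L : Type*) [LieRing L] : Prop :=
  ∀ x y₁ y₂ y₃ y₄ y₅ y₆ y₇ : L, ⁅⁅⁅⁅⁅⁅⁅x, y₁⁆, y₂⁆, y₃⁆, y₄⁆, y₅⁆, y₆⁆, y₇⁆ = 0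

/-- The defining relations, with central error terms `z` and `w`, of a descendant. -/
structure PreRel (p : ℕ) (a b z w : L) : Prop where
  nil : NilEight L
  hz : ∀ t : L, ⁅z, t⁆ = 0
  hw : ∀ t : L, ⁅w, t⁆ = 0
  rel_one : ⁅adPow a b 1, b⁆ = adPow a b 3 + adPow a b 5 + z
  rel_three : ⁅adPow a b 3, b⁆ = adPow a b 5 + w
  tors_one : p • adPow a b 1 = 0
  odd : Odd p

namespace PreRel

variable {p : ℕ} {a b z w : L} (h : PreRel p a b z w)

include h

theorem six_lie (t : L) : ⁅adPow a b 6, t⁆ = 0 := h.nil _ _ _ _ _ _ _ _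

theorem lie_six (t : L) : ⁅t, adPow a b 6⁆ = 0 := by
  rw [← lie_skew, h.six_lie, neg_zero]

theorem lie_z (t : L) : ⁅t, z⁆ = 0 := by
  rw [← lie_skew, h.hz, neg_zero]

theorem two_b : ⁅adPow a b 2, b⁆ = adPow a b 4 + adPow a b 6 := by
  have e := lie_lie_right (adPow a b 1) b a
  rw [show ⁅b, a⁆ = adPow a b 1 from rfl, lie_self, h.rel_one, add_lie, add_lie, h.hz] at e
  simp only [← adPow_succ, Nat.reduceAdd] at e
  rw [add_zero] at e
  exact (sub_eq_zero.mp e.symm).symm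

theorem two_one : ⁅adPow a b 2, adPow a b 1⁆ = -w := by
  rw [lie_adPow_succ, adPow_zero, h.two_b, add_lie, h.six_lie]
  simp only [← adPow_succ, Nat.reduceAdd]
  rw [h.rel_three]
  abel

theorem three_one : ⁅adPow a b 3, adPow a b 1⁆ = 0 := by
  have e := lie_adPow_succ a b (adPow a b 2) 1
  rw [h.two_one, neg_lie, h.hw] at e
  simp only [← adPow_succ, Nat.reduceAdd] at e
  rw [lie_self, neg_zero, zero_sub] at e
  exact neg_eq_zero.mp e.symm

theorem four_b : ⁅adPow a b 4, b⁆ = adPow a b 6 := by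
  have e := lie_adPow_succ a b (adPow a b 3) 0
  simp only [← adPow_succ, Nat.reduceAdd] at e
  rw [h.three_one, adPow_zero, h.rel_three, add_lie, h.hw, add_zero] at e
  exact (sub_eq_zero.mp e.symm).symm

theorem four_one_lie (t : L) : ⁅⁅adPow a b 4, adPow a b 1⁆, t⁆ = 0 := by
  rw [lie_adPow_succ, sub_lie]
  exact (congrArg₂ (· - ·) (h.nil _ _ _ _ _ _ _ _) (h.nil _ _ _ _ _ _ _ _)).trans (sub_zero 0)

theorem five_succ (n : ℕ) : ⁅adPow a b 5, adPow a b (n + 1)⁆ = 0 := by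
  induction n with
  | zero =>
    rw [lie_adPow_succ, ← adPow_succ, h.six_lie]
    exact (sub_zero _).trans (h.nil _ _ _ _ _ _ _ _)
  | succ n ih => rw [lie_adPow_succ, ih, ← adPow_succ, h.six_lie, zero_lie, sub_zero]

theorem four_two : ⁅adPow a b 4, adPow a b 2⁆ = 0 := by
  rw [lie_adPow_succ, h.four_one_lie, ← adPow_succ, h.five_succ, sub_zero]

theorem four_three : ⁅adPow a b 4, adPow a b 3⁆ = 0 := by
  rw [lie_adPow_succ, h.four_two, zero_lie, ← adPow_succ, h.five_succ, sub_zero]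

theorem three_two_add : ⁅adPow a b 3, adPow a b 2⁆ + ⁅adPow a b 4, adPow a b 1⁆ = 0 := by
  rw [lie_adPow_succ, h.three_one, zero_lie, ← adPow_succ]
  abel

theorem four_one_add : ⁅adPow a b 4, adPow a b 1⁆ + ⁅adPow a b 2, adPow a b 3⁆ = 0 := by
  have e := lie_lie_right (adPow a b 2) (adPow a b 1) b
  have e25 : ⁅adPow a b 2, adPow a b 5⁆ = 0 := by rw [← lie_skew, h.five_succ, neg_zero]
  rw [h.rel_one, h.two_one, h.two_b, neg_lie, h.hw, add_lie, h.six_lie, lie_add, lie_add,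
    h.lie_z, e25] at e
  simp only [add_zero, neg_zero, zero_sub] at e
  rw [e]
  abel

theorem nsmul_four_one : p • ⁅adPow a b 4, adPow a b 1⁆ = 0 := by
  rw [← lie_nsmul, h.tors_one, lie_zero]

theorem four_one : ⁅adPow a b 4, adPow a b 1⁆ = 0 := by
  have e2 : (2 : ℕ) • ⁅adPow a b 4, adPow a b 1⁆ = 0 := by
    have e := congrArg₂ (· + ·) h.three_two_add h.four_one_add
    rw [← lie_skew (adPow a b 3)] at e
    simp only [add_zero] at e
    rw [← e, two_nsmul]
    abel
  obtain ⟨k, hk⟩ := h.odd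
  have e := h.nsmul_four_one
  rwa [hk, add_nsmul, mul_comm, mul_nsmul', e2, nsmul_zero, zero_add, one_nsmul] at e

theorem three_two : ⁅adPow a b 3, adPow a b 2⁆ = 0 := by
  simpa [h.four_one] using h.three_two_add

theorem five_b : ⁅adPow a b 5, b⁆ = 0 := by
  have e := lie_adPow_succ a b (adPow a b 4) 0
  simp only [← adPow_succ, Nat.reduceAdd] at e
  rw [h.four_one, adPow_zero, h.four_b, h.six_lie, zero_sub] at e
  exact neg_eq_zero.mp e.symm

theorem lie_formula (i j k₁ k₂ k₃ k₄ k₅ k₆ i' j' l₁ l₂ l₃ l₄ l₅ l₆ : ℤ) :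
    ⁅i • a + j • b + k₁ • adPow a b 1 + k₂ • adPow a b 2 + k₃ • adPow a b 3
        + k₄ • adPow a b 4 + k₅ • adPow a b 5 + k₆ • adPow a b 6,
      i' • a + j' • b + l₁ • adPow a b 1 + l₂ • adPow a b 2 + l₃ • adPow a b 3
        + l₄ • adPow a b 4 + l₅ • adPow a b 5 + l₆ • adPow a b 6⁆ =
    (j * i' - i * j') • adPow a b 1 + (k₁ * i' - i * l₁) • adPow a b 2
      + ((k₂ * i' - i * l₂) + (k₁ * j' - j * l₁)) • adPow a b 3
      + ((k₃ * i' - i * l₃) + (k₂ * j' - j * l₂)) • adPow a b 4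
      + ((k₄ * i' - i * l₄) + (k₁ * j' - j * l₁) + (k₃ * j' - j * l₃)) • adPow a b 5
      + ((k₅ * i' - i * l₅) + (k₂ * j' - j * l₂) + (k₄ * j' - j * l₄)) • adPow a b 6
      + (k₁ * j' - j * l₁) • z
      + ((k₃ * j' - j * l₃) - (k₂ * l₁ - k₁ * l₂)) • w := by
  have s : ∀ n : ℕ, ⁅adPow a b n, a⁆ = adPow a b (n + 1) := fun n => rfl
  have s' : ∀ n : ℕ, ⁅a, adPow a b n⁆ = -adPow a b (n + 1) := fun n => by rw [← lie_skew, s]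
  have sb : ⁅b, a⁆ = adPow a b 1 := rfl
  have sb' : ⁅a, b⁆ = -adPow a b 1 := by rw [← lie_skew, sb]
  have sk : ∀ {x y t : L}, ⁅x, y⁆ = t → ⁅y, x⁆ = -t := fun e => by rw [← lie_skew, e]
  have f5 := h.five_succ
  simp only [lie_add, add_lie, lie_zsmul, zsmul_lie, s, s', sb, sb', lie_self, Nat.reduceAdd,
    h.six_lie, h.lie_six, h.rel_one, h.two_b, h.rel_three, h.four_b, h.five_b, h.two_one,
    h.three_one, h.three_two, h.four_one, h.four_two, h.four_three, f5 0, f5 1, f5 2, f5 3,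
    sk h.rel_one, sk h.two_b, sk h.rel_three, sk h.four_b, sk h.five_b, sk h.two_one,
    sk h.three_one, sk h.three_two, sk h.four_one, sk h.four_two, sk h.four_three,
    sk (f5 0), sk (f5 1), sk (f5 2), sk (f5 3)]
  have e7 : adPow a b 7 = 0 := h.six_lie a
  rw [e7]
  module

end PreRel

end Table

/-- The defining relations of a descendant with parameters `u, v, x, y`. -/
structure DescRel {L : Type*} [LieRing L] {p : ℕ} (u v x y : ZMod p) (a b : L) : Prop where
  nil : NilEight L
  odd : Odd p
  rel_one : ⁅adPow a b 1, b⁆ = adPow a b 3 + adPow a b 5 + u.val • adPow a b 6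
  rel_three : ⁅adPow a b 3, b⁆ = adPow a b 5 + v.val • adPow a b 6
  nsmul_a : p • a = x.val • adPow a b 6
  nsmul_b : p • b = y.val • adPow a b 6

theorem val_intCast_zsmul {L : Type*} [AddCommGroup L] {p : ℕ} [NeZero p] {c : L}
    (hc : p • c = 0) (n : ℤ) : (((n : ZMod p).val : ℕ) : ℤ) • c = n • c := by
  rw [ZMod.val_intCast]
  conv_rhs => rw [← Int.emod_add_mul_ediv n p]
  rw [add_zsmul, mul_comm, mul_zsmul, natCast_zsmul, hc, zsmul_zero, add_zero]

theorem val_add_zsmul {L : Type*} [AddCommGroup L] {p : ℕ} [NeZero p] (c : L)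
    (s t : ZMod p) : (((s + t).val : ℕ) : ℤ) • c + (((s.val + t.val) / p : ℕ) : ℤ) • (p • c) =
      ((s.val : ℕ) : ℤ) • c + ((t.val : ℕ) : ℤ) • c := by
  rw [ZMod.val_add, ← add_zsmul, ← natCast_zsmul c p, ← mul_zsmul, ← add_zsmul]
  congr 1
  have := Nat.mod_add_div (s.val + t.val) p
  rw [mul_comm]
  exact_mod_cast this

namespace DescRel

theorem nsmul_adPow {L : Type*} [LieRing L] {p : ℕ} {u v x y : ZMod p} {a b : L}
    (h : DescRel u v x y a b) (n : ℕ) : p • adPow a b (n + 1) = 0 := by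
  induction n with
  | zero =>
    have h6 : ⁅adPow a b 6, a⁆ = 0 := h.nil _ _ _ _ _ _ _ _
    rw [adPow_succ, adPow_zero, ← nsmul_lie, h.nsmul_b, nsmul_lie, h6, nsmul_zero]
  | succ n ih => rw [adPow_succ, ← nsmul_lie, ih, zero_lie]

theorem preRel {L : Type*} [LieRing L] {p : ℕ} {u v x y : ZMod p} {a b : L}
    (h : DescRel u v x y a b) :
    PreRel p a b (u.val • adPow a b 6) (v.val • adPow a b 6) where
  nil := h.nil
  hz t := by
    rw [nsmul_lie]
    exact (congrArg _ (h.nil _ _ _ _ _ _ _ _)).trans (nsmul_zero _)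
  hw t := by
    rw [nsmul_lie]
    exact (congrArg _ (h.nil _ _ _ _ _ _ _ _)).trans (nsmul_zero _)
  rel_one := h.rel_one
  rel_three := h.rel_three
  tors_one := h.nsmul_adPow 0
  odd := h.odd

variable {L : Type*} [LieRing L] {p : ℕ} [NeZero p] {u v x y : ZMod p} {a b : L}
  (h : DescRel u v x y a b)

/-- The element of `L` with the coordinates of an element of the model. -/
def eval (a b : L) (X : Model p u v x y) : L :=
  (X.a.val : ℤ) • a + (X.b.val : ℤ) • b + (X.c1.val : ℤ) • adPow a b 1
    + (X.c2.val : ℤ) • adPow a b 2 + (X.c3.val : ℤ) • adPow a b 3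
    + (X.c4.val : ℤ) • adPow a b 4 + (X.c5.val : ℤ) • adPow a b 5
    + (X.c6.val : ℤ) • adPow a b 6

include h

theorem val_add (n : ℕ) (s t : ZMod p) :
    ((s + t).val : ℤ) • adPow a b (n + 1) =
      (s.val : ℤ) • adPow a b (n + 1) + (t.val : ℤ) • adPow a b (n + 1) := by
  rw [← val_add_zsmul, h.nsmul_adPow, zsmul_zero, add_zero]

theorem eval_add (X Y : Model p u v x y) : eval a b (X + Y) = eval a b X + eval a b Y := by
  have ea := val_add_zsmul a X.a Y.a
  have eb := val_add_zsmul b X.b Y.b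
  rw [h.nsmul_a] at ea
  rw [h.nsmul_b] at eb
  have ec : ∀ (s : ZMod p) (n : ℕ), ((s * n).val : ℤ) • adPow a b 6 =
      (n : ℤ) • (s.val • adPow a b 6) := by
    intro s n
    have := val_intCast_zsmul (h.nsmul_adPow 5) (s.val * n : ℤ)
    push_cast at this
    rw [ZMod.natCast_zmod_val] at this
    rw [this, mul_comm, mul_zsmul, natCast_zsmul (adPow a b 6)]
  simp only [eval, Model.add_a, Model.add_b, Model.add_c1, Model.add_c2, Model.add_c3,
    Model.add_c4, Model.add_c5, Model.add_c6, h.val_add 0, h.val_add 1, h.val_add 2,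
    h.val_add 3, h.val_add 4, h.val_add 5]
  rw [carry, carry, ec, ec]
  rw [← eq_sub_iff_add_eq] at ea eb
  rw [ea, eb]
  abel

theorem eval_lie (X Y : Model p u v x y) : eval a b ⁅X, Y⁆ = ⁅eval a b X, eval a b Y⁆ := by
  obtain ⟨i, j, k₁, k₂, k₃, k₄, k₅, k₆⟩ := X
  obtain ⟨i', j', l₁, l₂, l₃, l₄, l₅, l₆⟩ := Y
  have e : ∀ (n : ℕ) (m : ℤ), ((m : ZMod p).val : ℤ) • adPow a b (n + 1) =
      m • adPow a b (n + 1) := fun n m => val_intCast_zsmul (h.nsmul_adPow n) m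
  simp only [eval, h.preRel.lie_formula]
  have c : ∀ s : ZMod p, ∃ n : ℤ, (n : ZMod p) = s ∧ n = s.val :=
    fun s => ⟨s.val, by simp, rfl⟩
  obtain ⟨i, rfl, hi⟩ := c i
  obtain ⟨j, rfl, hj⟩ := c j
  obtain ⟨k₁, rfl, hk₁⟩ := c k₁
  obtain ⟨k₂, rfl, hk₂⟩ := c k₂
  obtain ⟨k₃, rfl, hk₃⟩ := c k₃
  obtain ⟨k₄, rfl, hk₄⟩ := c k₄
  obtain ⟨k₅, rfl, hk₅⟩ := c k₅
  obtain ⟨i', rfl, hi'⟩ := c i'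
  obtain ⟨j', rfl, hj'⟩ := c j'
  obtain ⟨l₁, rfl, hl₁⟩ := c l₁
  obtain ⟨l₂, rfl, hl₂⟩ := c l₂
  obtain ⟨l₃, rfl, hl₃⟩ := c l₃
  obtain ⟨l₄, rfl, hl₄⟩ := c l₄
  obtain ⟨l₅, rfl, hl₅⟩ := c l₅
  obtain ⟨u', hu, hu'⟩ := c u
  obtain ⟨v', hv, hv'⟩ := c v
  rw [← hi, ← hj, ← hk₁, ← hk₂, ← hk₃, ← hk₄, ← hk₅, ← hi', ← hj', ← hl₁, ← hl₂, ← hl₃,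
    ← hl₄, ← hl₅, ← natCast_zsmul _ u.val, ← natCast_zsmul _ v.val, ← hu', ← hv']
  simp only [Model.lie_a, Model.lie_b, Model.lie_c1, Model.lie_c2, Model.lie_c3, Model.lie_c4,
    Model.lie_c5, Model.lie_c6, ZMod.val_zero]
  simp only [← hu, ← hv]
  simp only [← Int.cast_mul, ← Int.cast_sub, ← Int.cast_add, e 0, e 1, e 2, e 3, e 4, e 5]
  module

/-- The homomorphism from the model determined by elements satisfying the relations. -/
def hom : Model p u v x y →ₗ⁅ℤ⁆ L where
  toFun := eval a b
  map_add' := h.eval_add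
  map_smul' n X := map_zsmul (AddMonoidHom.mk' (eval a b) h.eval_add) n X
  map_lie' {X Y} := h.eval_lie X Y

end DescRel

section LowerCentralSeries

open LieModule

theorem lie_mem_lowerCentralSeries_succ {L : Type*} [LieRing L] {k : ℕ} {m : L}
    (hm : m ∈ lowerCentralSeries ℤ L L k) (t : L) :
    ⁅t, m⁆ ∈ lowerCentralSeries ℤ L L (k + 1) := by
  rw [lowerCentralSeries_succ]
  exact LieSubmodule.lie_mem_lie (LieSubmodule.mem_top t) hm

theorem lie_mem_lowerCentralSeries_succ' {L : Type*} [LieRing L] {k : ℕ} {m : L}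
    (hm : m ∈ lowerCentralSeries ℤ L L k) (t : L) :
    ⁅m, t⁆ ∈ lowerCentralSeries ℤ L L (k + 1) := by
  rw [← lie_skew]
  exact neg_mem (lie_mem_lowerCentralSeries_succ hm t)

theorem mem_lowerCentralSeries_zero {L : Type*} [LieRing L] (t : L) :
    t ∈ lowerCentralSeries ℤ L L 0 := by
  simp

theorem adPow_mem_lowerCentralSeries {L : Type*} [LieRing L] (a b : L) (n : ℕ) :
    adPow a b n ∈ lowerCentralSeries ℤ L L n := by
  induction n with
  | zero => exact mem_lowerCentralSeries_zero _
  | succ n ih => exact lie_mem_lowerCentralSeries_succ' ih a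

theorem nilEight_of_lowerCentralSeries {L : Type*} [LieRing L]
    (h : lowerCentralSeries ℤ L L 7 = ⊥) : NilEight L := by
  intro x y₁ y₂ y₃ y₄ y₅ y₆ y₇
  refine (LieSubmodule.mem_bot (R := ℤ) (L := L) _).mp ?_
  rw [← h]
  iterate 7 refine lie_mem_lowerCentralSeries_succ' ?_ _
  exact mem_lowerCentralSeries_zero _

theorem lowerCentralSeries_succ_subset {L : Type*} [LieRing L] {k : ℕ}
    (V : AddSubgroup L) (h : ∀ t : L, ∀ m ∈ lowerCentralSeries ℤ L L k, ⁅t, m⁆ ∈ V) :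
    ∀ m ∈ lowerCentralSeries ℤ L L (k + 1), m ∈ V := by
  intro m hm
  rw [lowerCentralSeries_succ, ← LieSubmodule.mem_toSubmodule,
    LieSubmodule.lieIdeal_oper_eq_linear_span'] at hm
  induction hm using Submodule.span_induction with
  | mem m hm =>
    obtain ⟨t, -, n, hn, rfl⟩ := hm
    exact h t n hn
  | zero => exact zero_mem _
  | add _ _ _ _ h₁ h₂ => exact add_mem h₁ h₂
  | smul r _ _ h₁ => exact zsmul_mem h₁ r

theorem lowerCentralSeries_subset {L : Type*} [LieRing L] (V : ℕ → AddSubgroup L)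
    (h₀ : ∀ x, x ∈ V 0) (h : ∀ (k : ℕ) (x m : L), m ∈ V k → ⁅(x : L), m⁆ ∈ V (k + 1)) (k : ℕ) :
    ∀ m ∈ lowerCentralSeries ℤ L L k, m ∈ V k := by
  induction k with
  | zero => exact fun m _ => h₀ m
  | succ k ih => exact lowerCentralSeries_succ_subset _ fun t m hm => h k t m (ih m hm)

theorem map_mem_lowerCentralSeries {L M : Type*} [LieRing L] [LieRing M] (f : L →ₗ⁅ℤ⁆ M) (k : ℕ) :
    ∀ m ∈ lowerCentralSeries ℤ L L k, f m ∈ lowerCentralSeries ℤ M M k :=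
  lowerCentralSeries_subset (fun k => (lowerCentralSeries ℤ M M k).toAddSubgroup.comap
      (f : L →+ M))
    (fun _ => mem_lowerCentralSeries_zero _)
    (fun k t m hm => by
      change f ⁅t, m⁆ ∈ lowerCentralSeries ℤ M M (k + 1)
      rw [LieHom.map_lie]
      exact lie_mem_lowerCentralSeries_succ hm _) k

theorem exists_mem_lowerCentralSeries_map_eq {L M : Type*} [LieRing L]
    [LieRing M] (f : L →ₗ⁅ℤ⁆ M) (hf : Function.Surjective f) (k : ℕ) :
    ∀ m ∈ lowerCentralSeries ℤ M M k, ∃ l ∈ lowerCentralSeries ℤ L L k, f l = m :=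
  lowerCentralSeries_subset (fun k => (lowerCentralSeries ℤ L L k).toAddSubgroup.map
      (f : L →+ M))
    (fun m => by
      obtain ⟨l, rfl⟩ := hf m
      exact ⟨l, mem_lowerCentralSeries_zero _, rfl⟩)
    (fun k t m hm => by
      obtain ⟨l, hl, rfl⟩ := hm
      obtain ⟨s, rfl⟩ := hf t
      exact ⟨⁅s, l⁆, lie_mem_lowerCentralSeries_succ hl _, LieHom.map_lie f s l⟩) k

end LowerCentralSeries

namespace Model

variable {p : ℕ} [NeZero p] {u v x y : ZMod p}

/-- The coordinate filtration of the model. -/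
def filtration (k : ℕ) : AddSubgroup (Model p u v x y) where
  carrier := {X | (1 ≤ k → X.a = 0 ∧ X.b = 0) ∧ (2 ≤ k → X.c1 = 0) ∧ (3 ≤ k → X.c2 = 0) ∧
    (4 ≤ k → X.c3 = 0) ∧ (5 ≤ k → X.c4 = 0) ∧ (6 ≤ k → X.c5 = 0) ∧ (7 ≤ k → X.c6 = 0)}
  zero_mem' := by simp
  add_mem' := by
    rintro X Y ⟨h1, h2, h3, h4, h5, h6, h7⟩ ⟨g1, g2, g3, g4, g5, g6, g7⟩
    refine ⟨fun hk => ?_, fun hk => ?_, fun hk => ?_, fun hk => ?_, fun hk => ?_, fun hk => ?_,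
      fun hk => ?_⟩
    · simp [h1 hk, g1 hk]
    · simp [h2 hk, g2 hk]
    · simp [h3 hk, g3 hk]
    · simp [h4 hk, g4 hk]
    · simp [h5 hk, g5 hk]
    · simp [h6 hk, g6 hk]
    · simp [h7 hk, g7 hk, h1 (by omega)]
  neg_mem' := by
    rintro X ⟨h1, h2, h3, h4, h5, h6, h7⟩
    refine ⟨fun hk => ?_, fun hk => ?_, fun hk => ?_, fun hk => ?_, fun hk => ?_, fun hk => ?_,
      fun hk => ?_⟩
    · simp [h1 hk]
    · simp [h2 hk]
    · simp [h3 hk]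
    · simp [h4 hk]
    · simp [h5 hk]
    · simp [h6 hk]
    · simp [h7 hk, h1 (by omega)]

theorem lowerCentralSeries_subset_filtration (k : ℕ) :
    ∀ X ∈ LieModule.lowerCentralSeries ℤ (Model p u v x y) (Model p u v x y) k,
      X ∈ filtration k := by
  refine lowerCentralSeries_subset _ (fun X => by simp [filtration]) ?_ k
  rintro k X Y ⟨h1, h2, h3, h4, h5, h6, h7⟩
  refine ⟨fun hk => ?_, fun hk => ?_, fun hk => ?_, fun hk => ?_, fun hk => ?_, fun hk => ?_,
    fun hk => ?_⟩
  · simp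
  · simp [h1 (by omega)]
  · simp [h1 (by omega), h2 (by omega)]
  · simp [h1 (by omega), h2 (by omega), h3 (by omega)]
  · simp [h1 (by omega), h3 (by omega), h4 (by omega)]
  · simp [h1 (by omega), h2 (by omega), h4 (by omega), h5 (by omega)]
  · simp [h1 (by omega), h2 (by omega), h3 (by omega), h4 (by omega), h5 (by omega),
      h6 (by omega)]

theorem lowerCentralSeries_seven :
    LieModule.lowerCentralSeries ℤ (Model p u v x y) (Model p u v x y) 7 = ⊥ := by
  rw [LieSubmodule.eq_bot_iff]
  intro X hX
  obtain ⟨h1, h2, h3, h4, h5, h6, h7⟩ := lowerCentralSeries_subset_filtration 7 X hX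
  norm_num at h1 h2 h3 h4 h5 h6 h7
  ext <;> simp [*]

theorem adPow_gen_six : adPow genA genB 6 = (top 1 : Model p u v x y) := by
  ext <;> simp [adPow_one, adPow_two, adPow_three, adPow_four, adPow_five, adPow_six, -lie_lie]

theorem nilEight : NilEight (Model p u v x y) :=
  nilEight_of_lowerCentralSeries lowerCentralSeries_seven

theorem lieClassEq (hp : 1 < p) : LieClassEq (Model p u v x y) 7 := by
  refine ⟨lowerCentralSeries_seven, fun h => ?_⟩
  have h6 : adPow genA genB 6 ∈
    LieModule.lowerCentralSeries ℤ (Model p u v x y) (Model p u v x y) 6 :=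
    adPow_mem_lowerCentralSeries _ _ _
  rw [show 6 = 7 - 1 from rfl, h, LieSubmodule.mem_bot, adPow_gen_six] at h6
  have : (1 : ZMod p) = 0 := congrArg Model.c6 h6
  have := Fact.mk hp
  exact one_ne_zero ‹(1 : ZMod p) = 0›

theorem descRel (hp : Odd p) : DescRel u v x y (genA : Model p u v x y) genB where
  nil := nilEight
  odd := hp
  rel_one := by
    rw [adPow_gen_six, val_nsmul_top]
    ext <;> simp [adPow_one, adPow_two, adPow_three, adPow_four, adPow_five, -lie_lie]
  rel_three := by
    rw [adPow_gen_six, val_nsmul_top]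
    ext <;> simp [adPow_one, adPow_two, adPow_three, adPow_four, adPow_five, -lie_lie]
  nsmul_a := by
    rw [adPow_gen_six, val_nsmul_top, p_nsmul]
    ext <;> simp
  nsmul_b := by
    rw [adPow_gen_six, val_nsmul_top, p_nsmul]
    ext <;> simp

theorem eval_gen (hp : 1 < p) (X : Model p u v x y) : DescRel.eval genA genB X = X := by
  have := Fact.mk hp
  simp only [DescRel.eval, natCast_zsmul, nsmul_eq]
  ext <;> simp [adPow_one, adPow_two, adPow_three, adPow_four, adPow_five, adPow_six, -lie_lie,
    ZMod.val_one, Nat.div_eq_of_lt (ZMod.val_lt _)]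

theorem injective_of_top {L : Type*} [LieRing L] [Fact p.Prime]
    (f : Model p u v x y →ₗ⁅ℤ⁆ L) (h : f (top 1) ≠ 0) : Function.Injective f := by
  have ht : ∀ t : ZMod p, f (top t) = 0 → t = 0 := by
    intro t ht
    by_contra h0
    apply h
    rw [← inv_mul_cancel₀ h0, ← val_nsmul_top, map_nsmul, ht, nsmul_zero]
  rw [injective_iff_map_eq_zero]
  intro X hX
  obtain ⟨A, hA⟩ : ∃ A : Model p u v x y, A = genA := ⟨_, rfl⟩
  obtain ⟨B, hB⟩ : ∃ B : Model p u v x y, B = genB := ⟨_, rfl⟩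
  have hb : X.b = 0 := by
    refine ht _ ?_
    rw [show top X.b = ⁅⁅⁅⁅⁅⁅X, A⁆, A⁆, A⁆, A⁆, A⁆, A⁆ by
      ext <;> simp [-lie_lie, hA]]
    simp [hX, -lie_lie]
  have ha : X.a = 0 := by
    refine ht _ ?_
    rw [show top X.a = ⁅⁅⁅⁅⁅⁅B, X⁆, A⁆, A⁆, A⁆, A⁆, A⁆ by
      ext <;> simp [-lie_lie, hA, hB, hb]]
    simp [hX, -lie_lie]
  have h1 : X.c1 = 0 := by
    refine ht _ ?_
    rw [show top X.c1 = ⁅⁅⁅⁅⁅X, A⁆, A⁆, A⁆, A⁆, A⁆ by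
      ext <;> simp [-lie_lie, hA, hb]]
    simp [hX, -lie_lie]
  have h2 : X.c2 = 0 := by
    refine ht _ ?_
    rw [show top X.c2 = ⁅⁅⁅⁅X, A⁆, A⁆, A⁆, A⁆ by
      ext <;> simp [-lie_lie, hA, hb, h1]]
    simp [hX, -lie_lie]
  have h3 : X.c3 = 0 := by
    refine ht _ ?_
    rw [show top X.c3 = ⁅⁅⁅X, A⁆, A⁆, A⁆ by
      ext <;> simp [-lie_lie, hA, hb, h1, h2]]
    simp [hX, -lie_lie]
  have h4 : X.c4 = 0 := by
    refine ht _ ?_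
    rw [show top X.c4 = ⁅⁅X, A⁆, A⁆ by
      ext <;> simp [-lie_lie, hA, hb, h1, h2, h3]]
    simp [hX, -lie_lie]
  have h5 : X.c5 = 0 := by
    refine ht _ ?_
    rw [show top X.c5 = ⁅X, A⁆ by
      ext <;> simp [-lie_lie, hA, hb, h1, h2, h3, h4]]
    simp [hX, -lie_lie]
  have h6 : X.c6 = 0 := by
    refine ht _ ?_
    rw [show top X.c6 = X by
      ext <;> simp [ha, hb, h1, h2, h3, h4, h5]]
    exact hX
  ext <;> simp [*]

/-- The coordinates of an element of the model. -/
def equivPi : Model p u v x y ≃ (Fin 8 → ZMod p) where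
  toFun X := ![X.a, X.b, X.c1, X.c2, X.c3, X.c4, X.c5, X.c6]
  invFun f := ⟨f 0, f 1, f 2, f 3, f 4, f 5, f 6, f 7⟩
  left_inv _ := rfl
  right_inv f := by
    ext i
    fin_cases i <;> rfl

theorem natCard : Nat.card (Model p u v x y) = p ^ 8 := by
  rw [Nat.card_congr equivPi, Nat.card_eq_fintype_card]
  simp [ZMod.card]

end Model

theorem adPow_map {L M : Type*} [LieRing L] [LieRing M] (f : L →ₗ⁅ℤ⁆ M) (a b : L) (n : ℕ) :
    f (adPow a b n) = adPow (f a) (f b) n := by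
  induction n with
  | zero => rfl
  | succ n ih => rw [adPow_succ, LieHom.map_lie, ih, adPow_succ]

theorem DescRel.map {p : ℕ} {u v x y : ZMod p} {L M : Type*} [LieRing L] [LieRing M]
    {a b : L} (h : DescRel u v x y a b) (f : L →ₗ⁅ℤ⁆ M) (hM : NilEight M) :
    DescRel u v x y (f a) (f b) where
  nil := hM
  odd := h.odd
  rel_one := by
    simpa only [map_add, LieHom.map_lie, adPow_map, map_nsmul] using congrArg f h.rel_one
  rel_three := by
    simpa only [map_add, LieHom.map_lie, adPow_map, map_nsmul] using congrArg f h.rel_three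
  nsmul_a := by simpa only [adPow_map, map_nsmul] using congrArg f h.nsmul_a
  nsmul_b := by simpa only [adPow_map, map_nsmul] using congrArg f h.nsmul_b

theorem DescRel.hom_gen {p : ℕ} [Fact p.Prime] {u v x y : ZMod p} {L : Type*} [LieRing L]
    {a b : L} (h : DescRel u v x y a b) :
    h.hom Model.genA = a ∧ h.hom Model.genB = b := by
  have := Fact.mk (Fact.out : p.Prime).one_lt
  constructor
  · change DescRel.eval a b Model.genA = a
    simp [DescRel.eval, ZMod.val_one]
  · change DescRel.eval a b Model.genB = b
    simp [DescRel.eval, ZMod.val_one]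

theorem isLieIso_of_bijective {L M : Type*} [LieRing L] [LieRing M] (f : L →ₗ⁅ℤ⁆ M)
    (hf : Function.Bijective f) : IsLieIso L M :=
  ⟨Equiv.ofBijective f hf, fun x y => map_add f x y, fun x y => LieHom.map_lie f x y⟩

theorem IsLieIso.exists_hom {L M : Type*} [LieRing L] [LieRing M] (h : IsLieIso L M) :
    ∃ f : L →ₗ⁅ℤ⁆ M, Function.Bijective f := by
  obtain ⟨e, ha, hl⟩ := h
  exact ⟨{ (AddMonoidHom.mk' e ha).toIntLinearMap with map_lie' := hl _ _ }, e.bijective⟩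

theorem IsLieIso.symm {L M : Type*} [LieRing L] [LieRing M] (h : IsLieIso L M) :
    IsLieIso M L := by
  obtain ⟨e, ha, hl⟩ := h
  refine ⟨e.symm, fun x y => ?_, fun x y => ?_⟩
  · rw [Equiv.symm_apply_eq, ha, e.apply_symm_apply, e.apply_symm_apply]
  · rw [Equiv.symm_apply_eq, hl, e.apply_symm_apply, e.apply_symm_apply]

theorem IsLieIso.trans {L M N : Type*} [LieRing L] [LieRing M] [LieRing N]
    (h : IsLieIso L M) (h' : IsLieIso M N) : IsLieIso L N := by
  obtain ⟨e, ha, hl⟩ := h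
  obtain ⟨e', ha', hl'⟩ := h'
  exact ⟨e.trans e', fun x y => by simp [ha, ha'], fun x y => by simp [hl, hl']⟩

theorem IsLieIso.refl (L : Type*) [LieRing L] : IsLieIso L L :=
  ⟨Equiv.refl L, fun _ _ => rfl, fun _ _ => rfl⟩

namespace Model

variable {p : ℕ} [Fact p.Prime] {u v x y : ZMod p}

instance : Finite (Model p u v x y) := Finite.of_equiv _ equivPi.symm

theorem two_ne_zero_of_odd (hp : Odd p) : (2 : ZMod p) ≠ 0 := by
  have : ((2 : ℕ) : ZMod p) ≠ 0 := by
    rw [Ne, ZMod.natCast_eq_zero_iff]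
    intro h2
    have h2 := (Nat.prime_dvd_prime_iff_eq Fact.out Nat.prime_two).mp h2
    have := hp
    rw [h2] at this
    exact absurd this (by decide)
  exact_mod_cast this

theorem params_of_descRel {u' v' x' y' : ZMod p} {A B : Model p u v x y}
    (h : DescRel u' v' x' y' A B) (h6 : adPow A B 6 ≠ 0) :
    ∃ s d : ZMod p, s * s = 1 ∧ u' = s * (u + v * d) ∧ v' = s * v ∧ x' = s * x ∧ y' = y := by
  have h2 : (2 : ZMod p) ≠ 0 := two_ne_zero_of_odd h.odd
  obtain ⟨α, β, e₁, e₂, e₃, e₄, e₅, e₆⟩ := A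
  obtain ⟨γ, δ, d₁, d₂, d₃, d₄, d₅, d₆⟩ := B
  set A : Model p u v x y := ⟨α, β, e₁, e₂, e₃, e₄, e₅, e₆⟩ with hA
  set B : Model p u v x y := ⟨γ, δ, d₁, d₂, d₃, d₄, d₅, d₆⟩ with hB
  have ht : adPow A B 6 = top (α ^ 5 * (δ * α - γ * β)) := by
    ext <;> simp [adPow_one, adPow_two, adPow_three, adPow_four, adPow_five, adPow_six, -lie_lie,
      hA, hB]
    ring
  have hD : δ * α - γ * β ≠ 0 := by
    intro h0
    apply h6
    rw [ht, h0, mul_zero]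
    rfl
  have h₁ := h.rel_one
  have h₃ := h.rel_three
  have ha := h.nsmul_a
  have hb := h.nsmul_b
  rw [ht, val_nsmul_top] at h₁ h₃ ha hb
  rw [p_nsmul] at ha hb
  have hγ : γ = 0 := by
    have := congrArg Model.c2 h₁
    simp [adPow_one, adPow_two, adPow_three, adPow_four, adPow_five, -lie_lie, hA, hB] at this
    exact this.resolve_left hD
  subst hγ
  have hαδ : δ ≠ 0 ∧ α ≠ 0 := by simpa using hD
  obtain ⟨hδ, hα⟩ := hαδ
  have e : δ = α * α := by
    have := congrArg Model.c3 h₁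
    simp [adPow_one, adPow_two, adPow_three, adPow_four, adPow_five, -lie_lie, hA, hB] at this
    apply mul_left_cancel₀ (mul_ne_zero hδ hα)
    linear_combination this
  have hβ : β = 0 := by
    have := congrArg Model.c4 h₁
    simp [adPow_one, adPow_two, adPow_three, adPow_four, adPow_five, -lie_lie, hA, hB] at this
    have : 2 * (δ * α * α) * β = 0 := by
      linear_combination d₁ * α * e - this
    exact (mul_eq_zero.mp this).resolve_left (by simp [h2, hδ, hα])
  subst hβ
  have hs : α * α = 1 := by
    have := congrArg Model.c5 h₁
    simp [adPow_one, adPow_two, adPow_three, adPow_four, adPow_five, -lie_lie, hA, hB] at this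
    apply mul_left_cancel₀ (mul_ne_zero hδ (mul_ne_zero hα hδ))
    linear_combination -this + (d₂ * α - δ * e₁ + δ * α ^ 3) * e
  have hδ1 : δ = 1 := e.trans hs
  subst hδ1
  have hu := congrArg Model.c6 h₁
  have hv := congrArg Model.c6 h₃
  have hx := congrArg Model.c6 ha
  have hy := congrArg Model.c6 hb
  simp [adPow_one, adPow_two, adPow_three, adPow_four, adPow_five, -lie_lie, hA, hB] at hu hv hx hy
  refine ⟨α, 2 * d₂ - d₁ * d₁, hs, ?_, ?_, ?_, ?_⟩
  · linear_combination -hu - (d₃ * α - e₂ - v * e₁ + d₁ * α * (α ^ 2 + 1)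
      + u' * (α ^ 4 + α ^ 2 + 1)) * hs
  · linear_combination -hv - (v' * (α ^ 4 + α ^ 2 + 1) - v * α + d₁ * α ^ 3) * hs
  · linear_combination -hx - x' * (α ^ 4 + α ^ 2 + 1) * hs
  · linear_combination -hy - y' * (α ^ 4 + α ^ 2 + 1) * hs

theorem descRel_twist {s d : ZMod p} (hp : Odd p) (hs : s * s = 1) :
    DescRel (s * (u + v * (2 * d))) (s * v) (s * x) y
      (⟨s, 0, 0, 0, 0, 0, 0, 0⟩ : Model p u v x y) ⟨0, 1, 0, d, 0, 0, 0, 0⟩ ∧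
    adPow (⟨s, 0, 0, 0, 0, 0, 0, 0⟩ : Model p u v x y) ⟨0, 1, 0, d, 0, 0, 0, 0⟩ 6 = top 1 := by
  have h6 : adPow (⟨s, 0, 0, 0, 0, 0, 0, 0⟩ : Model p u v x y) ⟨0, 1, 0, d, 0, 0, 0, 0⟩ 6
      = top 1 := by
    ext <;> simp [adPow_one, adPow_two, adPow_three, adPow_four, adPow_five, adPow_six, -lie_lie,
      hs]
  refine ⟨⟨nilEight, hp, ?_, ?_, ?_, ?_⟩, h6⟩
  · rw [h6, val_nsmul_top]
    ext <;> simp [adPow_one, adPow_two, adPow_three, adPow_four, adPow_five, -lie_lie, hs]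
    · linear_combination -(s * d) * hs
    · ring
  · rw [h6, val_nsmul_top]
    ext <;> simp [adPow_one, adPow_two, adPow_three, adPow_four, adPow_five, -lie_lie, hs]
    ring
  · rw [h6, val_nsmul_top, p_nsmul]
    ext <;> simp [mul_comm]
  · rw [h6, val_nsmul_top, p_nsmul]
    ext <;> simp

theorem isLieIso_of_descRel {L : Type*} [LieRing L] [Finite L] (hL : Nat.card L = p ^ 8) {a b : L}
    (h : DescRel u v x y a b) (h6 : adPow a b 6 ≠ 0) : IsLieIso (Model p u v x y) L := by
  obtain ⟨ha, hb⟩ := h.hom_gen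
  refine isLieIso_of_bijective h.hom ?_
  refine (injective_of_top _ ?_).bijective_of_nat_card_le (by rw [natCard, hL])
  rwa [← adPow_gen_six, adPow_map, ha, hb]

theorem isLieIso_iff (hp : Odd p) {u' v' x' y' : ZMod p} :
    IsLieIso (Model p u' v' x' y') (Model p u v x y) ↔
      ∃ s d : ZMod p, s * s = 1 ∧ u' = s * (u + v * d) ∧ v' = s * v ∧ x' = s * x ∧ y' = y := by
  constructor
  · intro h
    obtain ⟨f, hf⟩ := h.exists_hom
    refine params_of_descRel ((descRel hp).map f nilEight) ?_
    rw [← adPow_map, adPow_gen_six, Ne, map_eq_zero_iff f hf.1]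
    intro h0
    exact one_ne_zero (congrArg Model.c6 h0 : (1 : ZMod p) = 0)
  · rintro ⟨s, d, hs, rfl, rfl, rfl, rfl⟩
    have h2 : (2 : ZMod p) ≠ 0 := two_ne_zero_of_odd hp
    obtain ⟨h, h6⟩ := descRel_twist (u := u) (v := v) (x := x) (y := y') (d := d / 2) hp hs
    rw [mul_div_cancel₀ _ h2] at h
    refine isLieIso_of_descRel natCard h ?_
    rw [h6]
    intro h0
    exact one_ne_zero (congrArg Model.c6 h0 : (1 : ZMod p) = 0)

end Model

/-- The homomorphism of Lie rings with a given underlying map. -/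
def LieHom.ofAdditive {L M : Type*} [LieRing L] [LieRing M] (f : L → M)
    (ha : ∀ s t, f (s + t) = f s + f t) (hl : ∀ s t, f ⁅s, t⁆ = ⁅f s, f t⁆) : L →ₗ⁅ℤ⁆ M :=
  { (AddMonoidHom.mk' f ha).toIntLinearMap with map_lie' := hl _ _ }

theorem isLieIso_quotient_iff {L M : Type*} [LieRing L] [LieRing M] (I : LieIdeal ℤ L) :
    IsLieIso (L ⧸ I) M ↔
      ∃ g : L →ₗ⁅ℤ⁆ M, Function.Surjective g ∧ ∀ t, g t = 0 ↔ t ∈ I := by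
  constructor
  · rintro ⟨e, ha, hl⟩
    let q : L → L ⧸ I := LieSubmodule.Quotient.mk
    refine ⟨LieHom.ofAdditive (fun t => e (q t)) (fun s t => ha (q s) (q t))
      (fun s t => hl (q s) (q t)), e.surjective.comp Quot.mk_surjective, fun t => ?_⟩
    have e0 : e 0 = 0 := by simpa using ha 0 0
    change e (q t) = 0 ↔ t ∈ I
    rw [← e0, e.apply_eq_iff_eq]
    exact LieSubmodule.Quotient.mk_eq_zero'
  · rintro ⟨g, hg, hI⟩
    have hker : ∀ s t : L, (LieSubmodule.Quotient.mk s : L ⧸ I) = LieSubmodule.Quotient.mk t ↔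
        g s = g t := fun s t => by
      rw [← sub_eq_zero (a := g s), ← map_sub, hI]
      exact Submodule.Quotient.eq _
    let f : L ⧸ I → M := Quotient.lift g fun s t h => (hker s t).mp (Quotient.sound h)
    refine ⟨Equiv.ofBijective f ⟨?_, ?_⟩, ?_, ?_⟩
    · rintro ⟨s⟩ ⟨t⟩ h
      exact (hker s t).mpr h
    · intro m
      obtain ⟨t, rfl⟩ := hg m
      exact ⟨LieSubmodule.Quotient.mk t, rfl⟩
    · rintro ⟨s⟩ ⟨t⟩
      exact map_add g s t
    · rintro ⟨s⟩ ⟨t⟩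
      exact LieHom.map_lie g s t

theorem exists_hom_FL {M : Type*} [LieRing M] (a b : M) :
    ∃ f : FL → M, (∀ s t, f (s + t) = f s + f t) ∧ (∀ s t, f ⁅s, t⁆ = ⁅f s, f t⁆) ∧
      f ga = a ∧ f gb = b :=
  let F := FreeLieAlgebra.lift ℤ ![a, b]
  ⟨F, map_add F, LieHom.map_lie F, FreeLieAlgebra.lift_of_apply _ _,
    FreeLieAlgebra.lift_of_apply _ _⟩

theorem exists_lift {M : Type*} [LieRing M] (a b : M) :
    ∃ f : FL →ₗ⁅ℤ⁆ M, f ga = a ∧ f gb = b :=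
  let ⟨f, ha, hl, h⟩ := exists_hom_FL a b
  ⟨LieHom.ofAdditive f ha hl, h⟩

theorem hom_FL_ext {M : Type*} [LieRing M] {f g : FL →ₗ⁅ℤ⁆ M} (ha : f ga = g ga)
    (hb : f gb = g gb) (t : FL) : f t = g t := by
  have key : ∀ f : FL →ₗ⁅ℤ⁆ M,
      ∃ f' : @LieHom ℤ FL M _ _ (FreeLieAlgebra.instLieAlgebra ℤ (Fin 2)) _ _,
      ∀ t, f' t = f t := fun f =>
    ⟨@LieHom.mk ℤ FL M _ _ (FreeLieAlgebra.instLieAlgebra ℤ (Fin 2)) _ _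
      (@LinearMap.mk ℤ ℤ _ _ _ FL M _ _ (FreeLieAlgebra.instLieAlgebra ℤ (Fin 2)).toModule _
        ⟨f, map_add f⟩ fun n t => by
          refine (congrArg f (int_smul_eq_zsmul _ n t)).trans ?_
          exact map_zsmul f n t) (LieHom.map_lie f _ _), fun _ => rfl⟩
  obtain ⟨f', hf⟩ := key f
  obtain ⟨g', hg⟩ := key g
  rw [← hf, ← hg]
  congr 1
  refine FreeLieAlgebra.hom_ext fun i => ?_
  rw [hf, hg]
  fin_cases i
  · exact ha
  · exact hb

section Presentation

open LieModule

/-- The ideal of relations of the Lie ring numbered 7.656. -/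
noncomputable abbrev relIdeal (p : ℕ) : LieIdeal ℤ FL :=
  LieSubmodule.lieSpan ℤ FL ({bab - ba3 - ba5, ba3b - ba5} ∪ {p • ga, p • gb}) ⊔
    lowerCentralSeries ℤ FL FL 6

theorem subset_relIdeal {p : ℕ} {t : FL}
    (ht : t ∈ ({bab - ba3 - ba5, ba3b - ba5} ∪ {p • ga, p • gb} : Set FL)) : t ∈ relIdeal p :=
  (le_sup_left : _ ≤ relIdeal p) (LieSubmodule.subset_lieSpan ht)

theorem lowerCentralSeries_le_relIdeal {p : ℕ} : lowerCentralSeries ℤ FL FL 6 ≤ relIdeal p :=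
  le_sup_right

theorem map_relIdeal_subset {M : Type*} [LieRing M] {p : ℕ} (f : FL →ₗ⁅ℤ⁆ M) (J : LieIdeal ℤ M)
    (hJ : lowerCentralSeries ℤ M M 6 ≤ J)
    (h₁ : ⁅adPow (f ga) (f gb) 1, f gb⁆ - adPow (f ga) (f gb) 3 - adPow (f ga) (f gb) 5 ∈ J)
    (h₃ : ⁅adPow (f ga) (f gb) 3, f gb⁆ - adPow (f ga) (f gb) 5 ∈ J)
    (ha : p • f ga ∈ J) (hb : p • f gb ∈ J) : ∀ t ∈ relIdeal p, f t ∈ J := by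
  have : relIdeal p ≤ J.comap f := by
    refine sup_le (LieSubmodule.lieSpan_le.mpr ?_) fun t ht =>
      LieIdeal.mem_comap.mpr (hJ (map_mem_lowerCentralSeries f 6 t ht))
    rintro t ((rfl | rfl) | (rfl | rfl))
    · rw [← adPow_map, ← adPow_map, ← adPow_map, ← LieHom.map_lie, ← map_sub, ← map_sub] at h₁
      exact LieIdeal.mem_comap.mpr h₁
    · rw [← adPow_map, ← adPow_map, ← LieHom.map_lie, ← map_sub] at h₃
      exact LieIdeal.mem_comap.mpr h₃
    · exact LieIdeal.mem_comap.mpr (by rwa [map_nsmul])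
    · exact LieIdeal.mem_comap.mpr (by rwa [map_nsmul])
  exact fun t ht => LieIdeal.mem_comap.mp (this ht)

theorem DescRel.map_eval {L M : Type*} [LieRing L] [LieRing M] {p : ℕ} {u v x y : ZMod p}
    (f : L →ₗ⁅ℤ⁆ M) (a b : L) (X : Model p u v x y) :
    f (eval a b X) = eval (f a) (f b) X := by
  simp only [eval, map_add, map_zsmul, adPow_map]

/-- A Lie ring with a surjection from the free Lie ring whose kernel is the ideal of relations. -/
structure IsPresented (p : ℕ) {Q : Type*} [LieRing Q] (f : FL →ₗ⁅ℤ⁆ Q) : Prop where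
  surj : Function.Surjective f
  ker : ∀ t, f t = 0 ↔ t ∈ relIdeal p

theorem exists_isPresented (p : ℕ) :
    ∃ f : FL →ₗ⁅ℤ⁆ presLie p {bab - ba3 - ba5, ba3b - ba5}, IsPresented p f :=
  let ⟨f, h₁, h₂⟩ := (isLieIso_quotient_iff (relIdeal p)).mp (IsLieIso.refl _)
  ⟨f, h₁, h₂⟩

namespace IsPresented

variable {p : ℕ} {Q : Type*} [LieRing Q] {f : FL →ₗ⁅ℤ⁆ Q} (h : IsPresented p f)

include h

theorem lowerCentralSeries_six : lowerCentralSeries ℤ Q Q 6 = ⊥ := by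
  rw [LieSubmodule.eq_bot_iff]
  intro q hq
  obtain ⟨t, ht, rfl⟩ := exists_mem_lowerCentralSeries_map_eq f h.surj 6 q hq
  exact (h.ker t).mpr (lowerCentralSeries_le_relIdeal ht)

theorem adPow_six : adPow (f ga) (f gb) 6 = 0 := by
  have := adPow_mem_lowerCentralSeries (f ga) (f gb) 6
  rwa [h.lowerCentralSeries_six, LieSubmodule.mem_bot] at this

theorem nilEight : NilEight Q := by
  refine nilEight_of_lowerCentralSeries ?_
  rw [lowerCentralSeries_succ, h.lowerCentralSeries_six, LieSubmodule.lie_bot]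

theorem rel_one : ⁅adPow (f ga) (f gb) 1, f gb⁆ =
    adPow (f ga) (f gb) 3 + adPow (f ga) (f gb) 5 := by
  have : f (⁅adPow ga gb 1, gb⁆ - adPow ga gb 3 - adPow ga gb 5) = 0 :=
    (h.ker _).mpr (subset_relIdeal (Or.inl (Or.inl rfl)))
  rw [map_sub, map_sub, LieHom.map_lie, adPow_map, adPow_map, adPow_map, sub_sub,
    sub_eq_zero] at this
  exact this

theorem rel_three : ⁅adPow (f ga) (f gb) 3, f gb⁆ = adPow (f ga) (f gb) 5 := by
  have : f (⁅adPow ga gb 3, gb⁆ - adPow ga gb 5) = 0 :=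
    (h.ker _).mpr (subset_relIdeal (Or.inl (Or.inr rfl)))
  rw [map_sub, LieHom.map_lie, adPow_map, adPow_map, sub_eq_zero] at this
  exact this

theorem nsmul_a : p • f ga = 0 := by
  rw [← map_nsmul]
  exact (h.ker _).mpr (subset_relIdeal (Or.inr (Or.inl rfl)))

theorem nsmul_b : p • f gb = 0 := by
  rw [← map_nsmul]
  exact (h.ker _).mpr (subset_relIdeal (Or.inr (Or.inr rfl)))

theorem descRel (hp : Odd p) (u v x y : ZMod p) : DescRel u v x y (f ga) (f gb) where
  nil := h.nilEight
  odd := hp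
  rel_one := by rw [h.rel_one, h.adPow_six, nsmul_zero, add_zero]
  rel_three := by rw [h.rel_three, h.adPow_six, nsmul_zero, add_zero]
  nsmul_a := by rw [h.nsmul_a, h.adPow_six, nsmul_zero]
  nsmul_b := by rw [h.nsmul_b, h.adPow_six, nsmul_zero]

variable [Fact p.Prime]

theorem surjective_hom (hp : Odd p) (u v x y : ZMod p) :
    Function.Surjective (h.descRel hp u v x y).hom := by
  intro q
  obtain ⟨t, rfl⟩ := h.surj q
  obtain ⟨g, ga', gb'⟩ := exists_lift (Model.genA : Model p u v x y) Model.genB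
  obtain ⟨hA, hB⟩ := (h.descRel hp u v x y).hom_gen
  refine ⟨g t, ?_⟩
  exact hom_FL_ext (f := (h.descRel hp u v x y).hom.comp g) (g := f)
    (by rw [LieHom.comp_apply, ga', hA]) (by rw [LieHom.comp_apply, gb', hB]) t

theorem isLieIso_quotient (hp : Odd p) (u v x y : ZMod p) :
    IsLieIso (Model p u v x y ⧸
      lowerCentralSeries ℤ (Model p u v x y) (Model p u v x y) 6) Q := by
  rw [isLieIso_quotient_iff]
  refine ⟨_, h.surjective_hom hp u v x y, fun X => ⟨fun hX => ?_, fun hX => ?_⟩⟩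
  · obtain ⟨g, hA, hB⟩ := exists_lift (Model.genA : Model p u v x y) Model.genB
    have hr := Model.descRel (u := u) (v := v) (x := x) (y := y) hp
    have h6 := adPow_mem_lowerCentralSeries (Model.genA : Model p u v x y) Model.genB 6
    rw [← Model.eval_gen (Fact.out : p.Prime).one_lt X, ← hA, ← hB, ← DescRel.map_eval]
    refine map_relIdeal_subset (p := p) g _ le_rfl ?_ ?_ ?_ ?_ _ ((h.ker _).mp ?_)
    · rw [hA, hB, hr.rel_one, sub_sub, add_sub_cancel_left]
      exact nsmul_mem h6 _
    · rw [hA, hB, hr.rel_three, add_sub_cancel_left]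
      exact nsmul_mem h6 _
    · rw [hA, hr.nsmul_a]
      exact nsmul_mem h6 _
    · rw [hB, hr.nsmul_b]
      exact nsmul_mem h6 _
    · rw [DescRel.map_eval]
      exact hX
  · have := map_mem_lowerCentralSeries (h.descRel hp u v x y).hom 6 X hX
    rwa [h.lowerCentralSeries_six, LieSubmodule.mem_bot] at this

end IsPresented

end Presentation

section Classification

open LieModule

theorem exists_model_isLieIso {p : ℕ} [Fact p.Prime] (hp : Odd p) {Q : Type*} [LieRing Q]
    {f : FL →ₗ⁅ℤ⁆ Q} (h : IsPresented p f) {L : Type*} [LieRing L] [Finite L]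
    (hcard : Nat.card L = p ^ 8) (hc : LieClassEq L 7)
    (hL : IsLieIso (L ⧸ lowerCentralSeries ℤ L L 6) Q) :
    ∃ u v x y : ZMod p, IsLieIso (Model p u v x y) L := by
  obtain ⟨g, hg, hker⟩ := (isLieIso_quotient_iff _).mp hL
  obtain ⟨h7, h6⟩ := hc
  have h7' : ∀ m ∈ lowerCentralSeries ℤ L L 7, m = 0 := fun m hm => by
    rwa [h7, LieSubmodule.mem_bot] at hm
  have hz : ∀ m ∈ lowerCentralSeries ℤ L L 6, ∀ t : L, ⁅m, t⁆ = 0 := fun m hm t =>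
    h7' _ (lie_mem_lowerCentralSeries_succ' hm t)
  have nil := nilEight_of_lowerCentralSeries h7
  obtain ⟨a, ha⟩ := hg (f ga)
  obtain ⟨b, hb⟩ := hg (f gb)
  have hc1 : ⁅adPow a b 1, b⁆ - (adPow a b 3 + adPow a b 5) ∈ lowerCentralSeries ℤ L L 6 := by
    rw [← hker, map_sub, map_add, LieHom.map_lie, adPow_map, adPow_map, adPow_map, ha, hb,
      h.rel_one, sub_self]
  have hc3 : ⁅adPow a b 3, b⁆ - adPow a b 5 ∈ lowerCentralSeries ℤ L L 6 := by
    rw [← hker, map_sub, LieHom.map_lie, adPow_map, adPow_map, ha, hb, h.rel_three, sub_self]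
  have hpa : p • a ∈ lowerCentralSeries ℤ L L 6 := by
    rw [← hker, map_nsmul, ha, h.nsmul_a]
  have hpb : p • b ∈ lowerCentralSeries ℤ L L 6 := by
    rw [← hker, map_nsmul, hb, h.nsmul_b]
  have pre : PreRel p a b (⁅adPow a b 1, b⁆ - (adPow a b 3 + adPow a b 5))
      (⁅adPow a b 3, b⁆ - adPow a b 5) :=
    { nil := nil
      hz := hz _ hc1
      hw := hz _ hc3
      rel_one := (add_sub_cancel _ _).symm
      rel_three := (add_sub_cancel _ _).symm
      tors_one := by rw [adPow_succ, adPow_zero, ← nsmul_lie, hz _ hpb]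
      odd := hp }
  have hr := h.descRel hp 0 0 0 0
  have hlift : ∀ t : L, ∃ X : Model p 0 0 0 0, ∃ ζ ∈ lowerCentralSeries ℤ L L 6,
      t = DescRel.eval a b X + ζ := by
    intro t
    obtain ⟨X, hX⟩ := h.surjective_hom hp 0 0 0 0 (g t)
    refine ⟨X, t - DescRel.eval a b X, ?_, (add_sub_cancel _ _).symm⟩
    rw [← hker, map_sub, DescRel.map_eval, ha, hb, ← hX, sub_eq_zero]
    rfl
  have hlift5 : ∀ t ∈ lowerCentralSeries ℤ L L 5, ∃ i : ℤ, ∃ ζ ∈ lowerCentralSeries ℤ L L 6,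
      t = i • adPow a b 5 + ζ := by
    intro t ht
    obtain ⟨X, hX, e⟩ := exists_mem_lowerCentralSeries_map_eq hr.hom
      (h.surjective_hom hp 0 0 0 0) 5 _ (map_mem_lowerCentralSeries g 5 t ht)
    obtain ⟨e₀, e₁, e₂, e₃, e₄, -⟩ := Model.lowerCentralSeries_subset_filtration 5 X hX
    norm_num at e₀ e₁ e₂ e₃ e₄
    refine ⟨X.c5.val, t - (X.c5.val : ℤ) • adPow a b 5, ?_, (add_sub_cancel _ _).symm⟩
    rw [← hker, map_sub, map_zsmul, adPow_map, ha, hb, ← e, sub_eq_zero]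
    change DescRel.eval (f ga) (f gb) X = _
    simp [DescRel.eval, e₀, e₁, e₂, e₃, e₄, h.adPow_six]
  have htop : ∀ m ∈ lowerCentralSeries ℤ L L 6, m ∈ AddSubgroup.zmultiples (adPow a b 6) := by
    refine lowerCentralSeries_succ_subset _ fun t m hm => ?_
    obtain ⟨X, ζ, hζ, rfl⟩ := hlift t
    obtain ⟨i, ξ, hξ, rfl⟩ := hlift5 m hm
    have hζ' : ∀ t : L, ⁅t, ξ⁆ = 0 := fun t => by rw [← lie_skew, hz ξ hξ, neg_zero]
    have h5 : ∀ n : ℕ, ⁅adPow a b (n + 1), adPow a b 5⁆ = 0 := fun n => by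
      rw [← lie_skew, pre.five_succ, neg_zero]
    have hb5 : ⁅b, adPow a b 5⁆ = 0 := by rw [← lie_skew, pre.five_b, neg_zero]
    have ha5 : ⁅a, adPow a b 5⁆ = -adPow a b 6 := by rw [← lie_skew, adPow_six]
    rw [lie_add, hζ', add_zero, lie_zsmul, add_lie, hz ζ hζ, add_zero, DescRel.eval]
    simp only [add_lie, zsmul_lie, hb5, ha5, h5 0, h5 1, h5 2, h5 3, h5 4, h5 5, zsmul_zero,
      add_zero]
    exact zsmul_mem (zsmul_mem (neg_mem (AddSubgroup.mem_zmultiples _)) _) _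
  have hne : adPow a b 6 ≠ 0 := by
    intro h0
    refine h6 ((LieSubmodule.eq_bot_iff _).mpr fun m hm => ?_)
    have := htop m hm
    rwa [h0, AddSubgroup.zmultiples_zero_eq_bot, AddSubgroup.mem_bot] at this
  have hp6 : p • adPow a b 6 = 0 := by
    rw [adPow_six, ← nsmul_lie, adPow_five, ← nsmul_lie, adPow_four, ← nsmul_lie, adPow_three,
      ← nsmul_lie, adPow_two, ← nsmul_lie, pre.tors_one]
    simp
  have hval : ∀ m ∈ lowerCentralSeries ℤ L L 6, ∃ s : ZMod p, m = s.val • adPow a b 6 := by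
    intro m hm
    obtain ⟨n, rfl⟩ := AddSubgroup.mem_zmultiples_iff.mp (htop m hm)
    exact ⟨n, by rw [← natCast_zsmul, val_intCast_zsmul hp6]⟩
  obtain ⟨u, hu⟩ := hval _ hc1
  obtain ⟨v, hv⟩ := hval _ hc3
  obtain ⟨x, hx⟩ := hval _ hpa
  obtain ⟨y, hy⟩ := hval _ hpb
  refine ⟨u, v, x, y, Model.isLieIso_of_descRel (a := a) (b := b) hcard
    ⟨nil, hp, ?_, ?_, hx, hy⟩ hne⟩
  · rw [← hu, add_sub_cancel]
  · rw [← hv, add_sub_cancel]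

end Classification

section Descendants

open LieModule

theorem lowerCentralSeries_eq_bot_of_isLieIso {L M : Type*} [LieRing L] [LieRing M]
    (h : IsLieIso L M) {k : ℕ} (hk : lowerCentralSeries ℤ L L k = ⊥) :
    lowerCentralSeries ℤ M M k = ⊥ := by
  obtain ⟨f, hf⟩ := h.exists_hom
  rw [LieSubmodule.eq_bot_iff]
  intro m hm
  obtain ⟨l, hl, rfl⟩ := exists_mem_lowerCentralSeries_map_eq f hf.2 k m hm
  rw [hk, LieSubmodule.mem_bot] at hl
  rw [hl, map_zero]

theorem IsLieIso.lieClassEq {L M : Type*} [LieRing L] [LieRing M]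
    (h : IsLieIso L M) {c : ℕ} (hc : LieClassEq L c) : LieClassEq M c :=
  ⟨lowerCentralSeries_eq_bot_of_isLieIso h hc.1,
    fun h0 => hc.2 (lowerCentralSeries_eq_bot_of_isLieIso h.symm h0)⟩

theorem IsLieIso.quotient_lowerCentralSeries {L M : Type*} [LieRing L] [LieRing M]
    (h : IsLieIso L M) (k : ℕ) :
    IsLieIso (L ⧸ lowerCentralSeries ℤ L L k) (M ⧸ lowerCentralSeries ℤ M M k) := by
  obtain ⟨f, hf⟩ := h.exists_hom
  obtain ⟨g, hg, hker⟩ := (isLieIso_quotient_iff (lowerCentralSeries ℤ M M k)).mp (IsLieIso.refl _)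
  rw [isLieIso_quotient_iff]
  refine ⟨g.comp f, hg.comp hf.2, fun t => ?_⟩
  rw [LieHom.comp_apply, hker]
  refine ⟨fun ht => ?_, map_mem_lowerCentralSeries f k t⟩
  obtain ⟨l, hl, e⟩ := exists_mem_lowerCentralSeries_map_eq f hf.2 k _ ht
  rwa [← hf.1 e]

theorem exists_lieRing_isLieIso {L : Type*} [LieRing L] {α : Type*} (e : L ≃ α) :
    ∃ s : LieRing α, @IsLieIso L α _ s := by
  let : AddCommGroup α := e.symm.addCommGroup
  have ha : ∀ x y : L, e (x + y) = e x + e y := fun x y => by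
    change _ = e (e.symm (e x) + e.symm (e y))
    simp
  have ha' : ∀ x y : α, e.symm (x + y) = e.symm x + e.symm y := fun x y => by
    rw [Equiv.symm_apply_eq, ha, e.apply_symm_apply, e.apply_symm_apply]
  have h0 : e 0 = 0 := by simpa using ha 0 0
  let : Bracket α α := ⟨fun x y => e ⁅e.symm x, e.symm y⁆⟩
  have hl : ∀ x y : α, ⁅x, y⁆ = e ⁅e.symm x, e.symm y⁆ := fun _ _ => rfl
  let s : LieRing α :=
    { add_lie := fun x y z => by rw [hl, hl, hl, ha', add_lie, ha]
      lie_add := fun x y z => by rw [hl, hl, hl, ha', lie_add, ha]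
      lie_self := fun x => by rw [hl, lie_self, h0]
      leibniz_lie := fun x y z => by
        simp only [hl, e.symm_apply_apply]
        rw [leibniz_lie, ha] }
  exact ⟨s, e, ha, fun x y => by rw [hl, e.symm_apply_apply, e.symm_apply_apply]⟩

theorem exists_descendant_isLieIso {p : ℕ} [Fact p.Prime] (hp : Odd p) (u v x y : ZMod p) :
    ∃ s : {s : LieRing (Fin (p ^ 8)) //
        IsMaxClassDescendantOf p (presLie p {bab - ba3 - ba5, ba3b - ba5}) s},
      @IsLieIso (Model p u v x y) (Fin (p ^ 8)) _ s.1 := by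
  have e : Nonempty (Model p u v x y ≃ Fin (p ^ 8)) :=
    ⟨Finite.equivFinOfCardEq Model.natCard⟩
  obtain ⟨e⟩ := e
  obtain ⟨s, hs⟩ := exists_lieRing_isLieIso e
  obtain ⟨f, hf⟩ := exists_isPresented p
  exact ⟨⟨s, hs.lieClassEq (Model.lieClassEq (Fact.out : p.Prime).one_lt),
    (hs.quotient_lowerCentralSeries 6).symm.trans (hf.isLieIso_quotient hp u v x y)⟩, hs⟩

theorem exists_model_isLieIso_descendant {p : ℕ} [Fact p.Prime] (hp : Odd p)
    (s : {s : LieRing (Fin (p ^ 8)) //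
        IsMaxClassDescendantOf p (presLie p {bab - ba3 - ba5, ba3b - ba5}) s}) :
    ∃ u v x y : ZMod p, @IsLieIso (Model p u v x y) (Fin (p ^ 8)) _ s.1 := by
  obtain ⟨s, hc, hq⟩ := s
  obtain ⟨f, hf⟩ := exists_isPresented p
  exact exists_model_isLieIso hp hf (Nat.card_fin _) hc hq

end Descendants

section NormalForms

variable {p : ℕ} [Fact p.Prime]

theorem eq_of_mul_natCast_eq {s : ZMod p} (hs : s * s = 1) {m n : ℕ} (hm : m ≤ (p - 1) / 2)
    (hn : n ≤ (p - 1) / 2) (h : s * (m : ZMod p) = n) : m = n := by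
  have hp := (Fact.out : p.Prime).two_le
  rcases mul_self_eq_one_iff.mp hs with rfl | rfl
  · rw [one_mul, ZMod.natCast_eq_natCast_iff', Nat.mod_eq_of_lt (by omega),
      Nat.mod_eq_of_lt (by omega)] at h
    exact h
  · have : ((m + n : ℕ) : ZMod p) = 0 := by
      push_cast
      rw [← h]
      ring
    rw [ZMod.natCast_eq_zero_iff] at this
    have := Nat.eq_zero_of_dvd_of_lt this (by omega)
    omega

theorem natCast_succ_ne_zero {m : ℕ} (hm : m < (p - 1) / 2) : ((m + 1 : ℕ) : ZMod p) ≠ 0 := by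
  rw [Ne, ZMod.natCast_eq_zero_iff]
  intro h
  have := Nat.le_of_dvd (Nat.succ_pos m) h
  omega

theorem exists_mul_eq_natCast (hp : Odd p) (t : ZMod p) :
    ∃ s : ZMod p, s * s = 1 ∧ ∃ m : ℕ, m ≤ (p - 1) / 2 ∧ s * t = m := by
  by_cases h : t.val ≤ (p - 1) / 2
  · exact ⟨1, one_mul 1, t.val, h, by simp⟩
  · have ht := ZMod.val_lt t
    obtain ⟨k, hk⟩ := hp
    refine ⟨-1, by ring, p - t.val, by omega, ?_⟩
    rw [Nat.cast_sub ht.le]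
    simp

/-- The index set of the normal forms. -/
abbrev NormalForm (p : ℕ) : Type :=
  ZMod p × ((Fin ((p - 1) / 2) × ZMod p) ⊕ (Fin ((p - 1) / 2) × ZMod p) ⊕
    Fin ((p - 1) / 2 + 1))

theorem card_normalForm (hp : Odd p) :
    Nat.card (NormalForm p) = p ^ 3 - (p ^ 2 - p) / 2 := by
  obtain ⟨k, hk⟩ := hp
  have h : (p - 1) / 2 = k := by omega
  have e : (p ^ 2 - p) / 2 = k * p := by
    rw [show p ^ 2 - p = k * p * 2 by rw [pow_two, ← Nat.sub_one_mul, hk]; simp; ring]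
    simp
  rw [e]
  simp only [NormalForm, Nat.card_prod, Nat.card_sum, Nat.card_zmod, Nat.card_fin, h]
  apply Nat.eq_sub_of_add_eq
  subst hk
  ring

/-- The parameters of a normal form. -/
def NormalForm.params : NormalForm p → ZMod p × ZMod p × ZMod p × ZMod p
  | (y, Sum.inl (i, x)) => (0, (i.1 + 1 : ℕ), x, y)
  | (y, Sum.inr (Sum.inl (i, x))) => ((i.1 + 1 : ℕ), 0, x, y)
  | (y, Sum.inr (Sum.inr j)) => (0, 0, (j.1 : ℕ), y)

/-- The Lie ring in normal form. -/
abbrev NormalForm.ring (ν : NormalForm p) : Type :=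
  Model p ν.params.1 ν.params.2.1 ν.params.2.2.1 ν.params.2.2.2

theorem NormalForm.eq_of_isLieIso (hp : Odd p) (ν μ : NormalForm p)
    (h : IsLieIso ν.ring μ.ring) : ν = μ := by
  obtain ⟨s, d, hs, hu, hv, hx, hy⟩ := (Model.isLieIso_iff hp).mp h
  have cancel : ∀ i j : Fin ((p - 1) / 2),
      ((i.1 + 1 : ℕ) : ZMod p) = s * ((j.1 + 1 : ℕ) : ZMod p) → i = j ∧ s = 1 := by
    intro i j e
    have := eq_of_mul_natCast_eq hs (by omega) (by omega) e.symm
    obtain rfl : i = j := Fin.ext (by omega)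
    exact ⟨rfl, mul_right_cancel₀ (natCast_succ_ne_zero i.2) (by rw [← e, one_mul])⟩
  have hs0 : s ≠ 0 := by
    rintro rfl
    simp at hs
  have nz := fun i : Fin ((p - 1) / 2) => natCast_succ_ne_zero i.2
  rcases ν with ⟨y, ⟨i, x⟩ | ⟨i, x⟩ | i⟩ <;> rcases μ with ⟨y', ⟨j, x'⟩ | ⟨j, x'⟩ | j⟩ <;>
    simp only [NormalForm.params] at hu hv hx hy <;> subst hy
  · obtain ⟨rfl, rfl⟩ := cancel i j hv
    rw [hx, one_mul]
  · exact absurd hv (by simpa using nz i)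
  · exact absurd hv (by simpa using nz i)
  · exact absurd hv.symm (mul_ne_zero hs0 (nz j))
  · obtain ⟨rfl, rfl⟩ := cancel i j (by simpa using hu)
    rw [hx, one_mul]
  · exact absurd hu (by simpa using nz i)
  · exact absurd hv.symm (mul_ne_zero hs0 (nz j))
  · exact absurd hu.symm (by simpa using ⟨hs0, by simpa using nz j⟩)
  · obtain rfl : i = j := Fin.ext (eq_of_mul_natCast_eq hs (by omega) (by omega) hx.symm).symm
    rfl

theorem NormalForm.exists_isLieIso (hp : Odd p) (u v x y : ZMod p) :
    ∃ ν : NormalForm p, IsLieIso ν.ring (Model p u v x y) := by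
  have pos : ∀ {t : ZMod p}, t ≠ 0 → ∃ s : ZMod p, s * s = 1 ∧
      ∃ i : Fin ((p - 1) / 2), ((i.1 + 1 : ℕ) : ZMod p) = s * t := by
    intro t ht
    obtain ⟨s, hs, m, hm, e⟩ := exists_mul_eq_natCast hp t
    have hm0 : m ≠ 0 := by
      rintro rfl
      have hs0 : s ≠ 0 := by
        rintro rfl
        simp at hs
      exact mul_ne_zero hs0 ht (by simpa using e)
    exact ⟨s, hs, ⟨m - 1, by omega⟩, by rw [e, Nat.sub_add_cancel (by omega)]⟩
  by_cases hv : v = 0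
  · by_cases hu : u = 0
    · obtain ⟨s, hs, m, hm, e⟩ := exists_mul_eq_natCast hp x
      exact ⟨(y, Sum.inr (Sum.inr ⟨m, by omega⟩)), (Model.isLieIso_iff hp).mpr
        ⟨s, 0, hs, by simp [params, hu], by simp [params, hv], e.symm, rfl⟩⟩
    · obtain ⟨s, hs, i, e⟩ := pos hu
      exact ⟨(y, Sum.inr (Sum.inl (i, s * x))), (Model.isLieIso_iff hp).mpr
        ⟨s, 0, hs, by simpa [params] using e, by simp [params, hv], rfl, rfl⟩⟩
  · obtain ⟨s, hs, i, e⟩ := pos hv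
    refine ⟨(y, Sum.inl (i, s * x)), (Model.isLieIso_iff hp).mpr
      ⟨s, -u / v, hs, ?_, e, rfl, rfl⟩⟩
    rw [mul_div_cancel₀ _ hv]
    simp [params]

end NormalForms

/-- The Lie ring 7.656 : `⟨a,b | [b,a,b]-[b,a,a,a]-[b,a,a,a,a,a],
[b,a,a,a,b]-[b,a,a,a,a,a], pa, pb, class 6⟩` has `p³ - (p² - p)/2` descendants of
order `p^8` (of maximal class 7). -/
theorem descendants_of_7_656 (p : ℕ) (hp : p.Prime) (h5 : 5 ≤ p) :
    Nat.card (Quot (fun s t :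
        {s : LieRing (Fin (p ^ 8)) //
          IsMaxClassDescendantOf p (presLie p {bab - ba3 - ba5, ba3b - ba5}) s} =>
      @IsLieIso _ _ s.1 t.1)) = p ^ 3 - (p ^ 2 - p) / 2 := by
  have := Fact.mk hp
  have hodd : Odd p := hp.odd_of_ne_two (by omega)
  rw [← card_normalForm hodd]
  choose F hF using fun ν : NormalForm p =>
    exists_descendant_isLieIso hodd ν.params.1 ν.params.2.1 ν.params.2.2.1 ν.params.2.2.2
  symm
  refine Nat.card_eq_of_bijective (fun ν => Quot.mk _ (F ν)) ⟨fun ν μ h => ?_, ?_⟩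
  · have equiv : Equivalence (fun s t : {s : LieRing (Fin (p ^ 8)) //
        IsMaxClassDescendantOf p (presLie p {bab - ba3 - ba5, ba3b - ba5}) s} =>
          @IsLieIso _ _ s.1 t.1) :=
      ⟨fun s => @IsLieIso.refl _ s.1, fun {s t} h => @IsLieIso.symm _ _ s.1 t.1 h,
        fun {s t r} h h' => @IsLieIso.trans _ _ _ s.1 t.1 r.1 h h'⟩
    have h' := equiv.eqvGen_iff.mp (Quot.eqvGen_exact h)
    have h₁ := hF ν
    have h₂ := @IsLieIso.trans _ _ _ _ (F ν).1 (F μ).1 h₁ h'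
    have h₃ := @IsLieIso.symm _ _ _ (F μ).1 (hF μ)
    exact NormalForm.eq_of_isLieIso hodd ν μ (@IsLieIso.trans _ _ _ _ (F μ).1 _ h₂ h₃)
  · rintro ⟨s⟩
    obtain ⟨u, v, x, y, hs⟩ := exists_model_isLieIso_descendant hodd s
    obtain ⟨ν, hν⟩ := NormalForm.exists_isLieIso hodd u v x y
    refine ⟨ν, Quot.sound ?_⟩
    have h₁ := @IsLieIso.symm _ _ _ (F ν).1 (hF ν)
    have h₂ := @IsLieIso.trans _ _ _ (F ν).1 _ _ h₁ hν
    exact @IsLieIso.trans _ _ _ (F ν).1 _ s.1 h₂ hs
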